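/- Let A be a finite commutative ring and let C be a free submodule of A^n (an (n,k)-linear code over A). Then C^⊥⊥ = C. -/

import Mathlib

/-- The dual code `C^⊥ = {y : ⟨x,y⟩ = 0 for all x ∈ C}` of a linear code `C ⊆ A^ι`
with respect to the standard bilinear form `⟨x,y⟩ = ∑ i, x i * y i`. -/
def dualCode {A : Type*} [CommRing A] {ι : Type*} [Fintype ι]
    (C : Submodule A (ι → A)) : Submodule A (ι → A) where
  carrier := {y | ∀ x ∈ C, ∑ i, x i * y i = 0}
  add_mem' := by
    intro a b ha hb x hx
    simp only [Set.mem_setOf_eq] at ha hb ⊢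
    simp [Pi.add_apply, mul_add, Finset.sum_add_distrib, ha x hx, hb x hx]
  zero_mem' := by intro x hx; simp
  smul_mem' := by
    intro c y hy x hx
    simp only [Set.mem_setOf_eq] at hy ⊢
    simp only [Pi.smul_apply, smul_eq_mul, mul_left_comm, ← Finset.mul_sum, hy x hx,
      mul_zero]

/-- Over a finite ring a proper submodule of a finite module is killed by a nonzero functional. -/
theorem exists_functional_of_ne_top {A : Type*} [CommRing A] [Fintype A] {M : Type*}
    [AddCommGroup M] [Module A M] [Module.Finite A M] (N : Submodule A M) (hN : N ≠ ⊤) :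
    ∃ g : M →ₗ[A] A, g ≠ 0 ∧ ∀ x ∈ N, g x = 0 := by
  obtain ⟨P, hP, hNP⟩ := (eq_top_or_exists_le_coatom N).resolve_left hN
  obtain ⟨m, hm, ⟨e⟩⟩ := isSimpleModule_iff_quot_maximal.mp (isSimpleModule_iff_isCoatom.mpr hP)
  have hdisj : Disjoint (m : Set A) (nonZeroDivisors A) := by
    rw [Set.disjoint_left]
    intro a ha hn
    exact hm.ne_top (Ideal.eq_top_of_isUnit_mem _ ha (IsArtinianRing.isUnit_of_mem_nonZeroDivisors hn))
  obtain ⟨s, hs, hs0⟩ := Submodule.exists_mem_ne_zero_of_ne_bot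
    (Ideal.bot_lt_annihilator_of_disjoint_nonZeroDivisors hdisj).ne'
  let l : (A ⧸ m) →ₗ[A] A := Submodule.liftQ m (LinearMap.toSpanSingleton A A s) (by
    intro a ha
    have := congrArg Subtype.val (Module.mem_annihilator.mp hs ⟨a, ha⟩)
    simpa [mul_comm] using this)
  refine ⟨l ∘ₗ e.toLinearMap ∘ₗ P.mkQ, ?_, ?_⟩
  · intro h
    obtain ⟨z, hz⟩ := P.mkQ_surjective (e.symm (Submodule.Quotient.mk 1))
    have h1 := LinearMap.congr_fun h z
    simp only [LinearMap.comp_apply, hz, LinearEquiv.coe_coe, LinearEquiv.apply_symm_apply] at h1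
    apply hs0
    have h2 : (1 : A) • s = 0 := h1
    simpa using h2
  · intro x hx
    have : P.mkQ x = 0 := by simpa using hNP hx
    simp [LinearMap.comp_apply, this]

/-- For a free submodule `C` of `A^n` over a finite commutative
ring `A` (an `(n,k)`-linear code), `C^⊥⊥ = C`. -/
theorem dualCode_dualCode_of_free
    {A : Type*} [CommRing A] [Fintype A] {n : ℕ}
    (C : Submodule A (Fin n → A)) (hC : Module.Free A C) :
    dualCode (dualCode C) = C := by
  classical
  let b := Module.Free.chooseBasis A C
  -- the pairing map with the basis vectors
  let T : (Fin n → A) →ₗ[A] (Module.Free.ChooseBasisIndex A C → A) :=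
    { toFun := fun y j => ∑ i, (b j : Fin n → A) i * y i
      map_add' := by
        intro x y
        ext j
        simp [mul_add, Finset.sum_add_distrib]
      map_smul' := by
        intro c y
        ext j
        simp [Finset.mul_sum, mul_left_comm] }
  have hT : ∀ y j, T y j = ∑ i, (b j : Fin n → A) i * y i := fun _ _ => rfl
  have hsurj : LinearMap.range T = ⊤ := by
    by_contra hne
    obtain ⟨g, hg0, hg⟩ := exists_functional_of_ne_top _ hne
    apply hg0
    have hsum : ∑ j, g (Pi.single j 1) • b j = 0 := by
      apply Subtype.ext
      ext i
      have h1 := hg (T (Pi.single i 1)) ⟨_, rfl⟩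
      rw [LinearMap.pi_apply_eq_sum_univ g] at h1
      have h2 : ∀ j, T (Pi.single i 1) j = (b j : Fin n → A) i := by
        intro j
        simp [hT, Pi.single_apply]
      simp only [h2, smul_eq_mul] at h1
      simp only [AddSubmonoidClass.coe_finset_sum, Submodule.coe_smul, Finset.sum_apply,
        Pi.smul_apply, smul_eq_mul, ZeroMemClass.coe_zero, Pi.zero_apply]
      rw [← h1]
      refine Finset.sum_congr rfl fun j _ => ?_
      rw [mul_comm]
      congr 2
      ext k
      simp [Pi.single_apply, eq_comm]
    have hz := Fintype.linearIndependent_iff.mp b.linearIndependent _ hsum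
    refine LinearMap.pi_ext' fun j => LinearMap.ext_ring ?_
    simpa using hz j
  rw [LinearMap.range_eq_top] at hsurj
  choose y hy using fun j : Module.Free.ChooseBasisIndex A C => hsurj (Pi.single j 1)
  apply le_antisymm
  · intro x hx
    have key : x = ∑ j, (∑ i, y j i * x i) • (b j : Fin n → A) := by
      ext i
      have hmem : Pi.single i 1 - ∑ j, T (Pi.single i 1) j • y j ∈ dualCode C := by
        have hT0 : T (Pi.single i 1 - ∑ j, T (Pi.single i 1) j • y j) = 0 := by
          rw [map_sub, map_sum]
          simp only [map_smul, hy]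
          ext k
          simp [Finset.sum_apply, Pi.single_apply]
        intro c hc
        have hc' := congrArg (fun z : C => (z : Fin n → A)) (b.sum_repr ⟨c, hc⟩)
        simp only [AddSubmonoidClass.coe_finset_sum, Submodule.coe_smul] at hc'
        rw [← hc']
        simp only [Finset.sum_apply, Pi.smul_apply, smul_eq_mul, Finset.sum_mul]
        rw [Finset.sum_comm]
        refine Finset.sum_eq_zero fun j _ => ?_
        have := congrFun hT0 j
        rw [hT] at this
        simp only [mul_assoc]
        rw [← Finset.mul_sum, this]
        simp
      have h := hx _ hmem
      have h2 : ∀ j, T (Pi.single i 1) j = (b j : Fin n → A) i := by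
        intro j
        simp [hT, Pi.single_apply]
      simp only [h2, Pi.sub_apply, sub_mul, Finset.sum_sub_distrib, Finset.sum_apply,
        Pi.smul_apply, smul_eq_mul, Finset.sum_mul] at h
      rw [Finset.sum_comm, sub_eq_zero] at h
      simp only [Pi.single_apply, ite_mul, one_mul, zero_mul, Finset.sum_ite_eq',
        Finset.sum_ite_eq, Finset.mem_univ, if_true] at h
      rw [h, Finset.sum_apply]
      refine Finset.sum_congr rfl fun j _ => ?_
      simp only [Pi.smul_apply, smul_eq_mul, mul_assoc]
      rw [← Finset.mul_sum, mul_comm]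
    rw [key]
    exact C.sum_mem fun j _ => C.smul_mem _ (b j).2
  · intro x hx y hy
    have := hy x hx
    simpa only [mul_comm] using this
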